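/- Positional awareness encoding: let σ > 0 and suppose the score matrix is uniform on valid positions, i.e., ω_{ij} = c for all j ≤ i (for a fixed real c). Define β_i = Σ_{j=1}^{i} W̃_{ij}, the retained attention mass of row i. Then β_1 < β_2 < ⋯ < β_n and β_n = 1; i.e., the accumulated attention over valid tokens is strictly increasing in the row index and reaches 1 exactly at the last row. -/

import Mathlib

open Finset

/-- The causal indicator matrix `C`, with `C i j = 1` if `j ≤ i` and `0` otherwise. -/
noncomputable def Cmask (n : ℕ) : Matrix (Fin n) (Fin n) ℝ :=
  fun i j => if j ≤ i then 1 else 0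

/-- The register matrix `P`, with `P i j = −(j−i)·σ` if `j > i` and `0` otherwise. -/
noncomputable def Pmat (n : ℕ) (σ : ℝ) : Matrix (Fin n) (Fin n) ℝ :=
  fun i j => if i < j then -(((j : ℕ) : ℝ) - ((i : ℕ) : ℝ)) * σ else 0

/-- `W = ω ⊙ C + P` (entrywise product with the causal mask, plus the registers). -/
noncomputable def Wmat (n : ℕ) (σ : ℝ) (ω : Matrix (Fin n) (Fin n) ℝ) :
    Matrix (Fin n) (Fin n) ℝ :=
  fun i j => ω i j * Cmask n i j + Pmat n σ i j

/-- Row-wise softmax: `S(M) i j = exp (M i j) / ∑ k, exp (M i k)`. -/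
noncomputable def softmaxRow (n : ℕ) (M : Matrix (Fin n) (Fin n) ℝ) :
    Matrix (Fin n) (Fin n) ℝ :=
  fun i j => Real.exp (M i j) / ∑ k, Real.exp (M i k)

/-- The FarSight attention matrix `W̃ = S(W) ⊙ C`. -/
noncomputable def Wtilde (n : ℕ) (σ : ℝ) (ω : Matrix (Fin n) (Fin n) ℝ) :
    Matrix (Fin n) (Fin n) ℝ :=
  fun i j => softmaxRow n (Wmat n σ ω) i j * Cmask n i j

/-- The vanilla causal softmax `A`, with `A i j = exp (ω i j) / ∑_{k ≤ i} exp (ω i k)`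
for `j ≤ i` and `A i j = 0` for `j > i`. -/
noncomputable def Avanilla (n : ℕ) (ω : Matrix (Fin n) (Fin n) ℝ) :
    Matrix (Fin n) (Fin n) ℝ :=
  fun i j => if j ≤ i then Real.exp (ω i j) / ∑ k ∈ Finset.Iic i, Real.exp (ω i k) else 0

/-- The total register weight `∑_{k > i} exp (-(k - i) σ)` seen by row `i`. -/
noncomputable def registerMass (n : ℕ) (σ : ℝ) (i : ℕ) : ℝ :=
  ∑ k : Fin n, if i < k then Real.exp (-(((k : ℕ) : ℝ) - (i : ℝ)) * σ) else 0

lemma registerMass_nonneg (n : ℕ) (σ : ℝ) (i : ℕ) : 0 ≤ registerMass n σ i :=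
  Finset.sum_nonneg fun k _ => by split_ifs <;> positivity

lemma registerMass_pos {n : ℕ} (σ : ℝ) {i : ℕ} (h : i + 1 < n) : 0 < registerMass n σ i := by
  refine Finset.sum_pos' (fun k _ => by split_ifs <;> positivity)
    ⟨⟨i + 1, h⟩, Finset.mem_univ _, ?_⟩
  rw [if_pos (Nat.lt_succ_self i)]
  positivity

lemma registerMass_last (n : ℕ) (σ : ℝ) : registerMass (n + 1) σ n = 0 :=
  Finset.sum_eq_zero fun k _ => if_neg (by omega)

lemma registerMass_succ_le (n : ℕ) (σ : ℝ) (i : ℕ) :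
    registerMass n σ (i + 1) ≤ registerMass n σ i := by
  cases n with
  | zero => simp [registerMass]
  | succ n =>
    unfold registerMass
    rw [Fin.sum_univ_succ, Fin.sum_univ_castSucc, if_neg (by simp), zero_add]
    refine (Finset.sum_le_sum fun k _ => le_of_eq ?_).trans
      (le_add_of_nonneg_right (by split_ifs <;> positivity))
    simp

lemma sum_Iic_Wtilde_of_uniform {n : ℕ} {σ c : ℝ} {ω : Matrix (Fin n) (Fin n) ℝ}
    (hω : ∀ i j : Fin n, j ≤ i → ω i j = c) (i : Fin n) :
    ∑ j ∈ Finset.Iic i, Wtilde n σ ω i j =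
      ((i : ℕ) + 1) * Real.exp c / (((i : ℕ) + 1) * Real.exp c + registerMass n σ i) := by
  have hvalid : ∀ j ∈ Finset.Iic i, Real.exp (Wmat n σ ω i j) = Real.exp c := fun j hj => by
    have hji : j ≤ i := Finset.mem_Iic.1 hj
    simp [Wmat, Cmask, Pmat, hji, hω i j hji, not_lt.2 hji]
  have hden : ∑ k, Real.exp (Wmat n σ ω i k) =
      ((i : ℕ) + 1) * Real.exp c + registerMass n σ i := by
    have hsplit : ∀ k, Real.exp (Wmat n σ ω i k) = (if k ∈ Finset.Iic i then Real.exp c else 0) +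
        if (i : ℕ) < k then Real.exp (-(((k : ℕ) : ℝ) - ((i : ℕ) : ℝ)) * σ) else 0 := fun k => by
      rcases le_or_gt k i with h | h
      · rw [hvalid k (Finset.mem_Iic.2 h), if_pos (Finset.mem_Iic.2 h),
          if_neg (not_lt.2 (Fin.le_def.1 h)), add_zero]
      · simp [Wmat, Cmask, Pmat, h, not_le.2 h]
    rw [Finset.sum_congr rfl fun k _ => hsplit k, Finset.sum_add_distrib, Finset.sum_ite_mem,
      Finset.univ_inter, Finset.sum_const, Fin.card_Iic, nsmul_eq_mul, registerMass]
    push_cast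
    rfl
  have hterm : ∀ j ∈ Finset.Iic i, Wtilde n σ ω i j =
      Real.exp c / (((i : ℕ) + 1) * Real.exp c + registerMass n σ i) := fun j hj => by
    rw [Wtilde, softmaxRow, hden, hvalid j hj, Cmask, if_pos (Finset.mem_Iic.1 hj), mul_one]
  rw [Finset.sum_congr rfl hterm, Finset.sum_const, Fin.card_Iic, nsmul_eq_mul, mul_div_assoc]
  push_cast
  rfl

/-- Positional awareness encoding: if `σ > 0` and the score matrix is uniform on valid
positions (`ω i j = c` for all `j ≤ i`), then the retained attention masses
`β i = ∑_{j ≤ i} W̃ i j` are strictly increasing in the row index `i`, and the last one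
equals `1`. -/
theorem farsight_positional_awareness (n : ℕ) (σ : ℝ) (hσ : 0 < σ) (c : ℝ)
    (ω : Matrix (Fin (n + 1)) (Fin (n + 1)) ℝ)
    (hω : ∀ i j : Fin (n + 1), j ≤ i → ω i j = c) :
    StrictMono (fun i : Fin (n + 1) => ∑ j ∈ Finset.Iic i, Wtilde (n + 1) σ ω i j) ∧
    (∑ j ∈ Finset.Iic (Fin.last n), Wtilde (n + 1) σ ω (Fin.last n) j = 1) := by
  refine ⟨Fin.strictMono_iff_lt_succ.2 fun i => ?_, ?_⟩
  · simp only [sum_Iic_Wtilde_of_uniform hω, Fin.val_castSucc, Fin.val_succ]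
    have hpos := registerMass_pos σ (Nat.succ_lt_succ i.isLt)
    have hnonneg := registerMass_nonneg (n + 1) σ (i + 1)
    have hle := registerMass_succ_le (n + 1) σ i
    rw [div_lt_div_iff₀ (by positivity) (by positivity)]
    push_cast
    have hc := Real.exp_pos c
    have hmul := mul_le_mul_of_nonneg_left hle
      (by positivity : 0 ≤ ((i : ℕ) + 1 : ℝ) * Real.exp c)
    nlinarith [mul_pos hc hpos]
  · rw [sum_Iic_Wtilde_of_uniform hω, Fin.val_last, registerMass_last, add_zero]
    exact div_self (by positivity)
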